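/- Let ρ be a Borel probability measure on 𝕊^{d−1} with V(ρ) ≤ 3/8, let α > 0, let 𝓔 : 𝕊^{d−1} → ℝ be bounded and c₁-Lipschitz, and suppose that −(1/α) log ‖ω_α‖_{L¹(ρ)} − 𝓔̲ ≤ ε for some ε ≥ 0. Then 0 ≤ 𝓔( E(ρ)/|E(ρ)| ) − 𝓔̲ ≤ 2√(2/3) c₁ C_{α,𝓔} V(ρ)^{1/2} + ε. -/

import Mathlib

open MeasureTheory Real RealInnerProductSpace

noncomputable section

/-- The unit sphere `𝕊^{d-1}` in `ℝ^d`. -/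
def sph (d : ℕ) : Set (EuclideanSpace ℝ (Fin d)) := Metric.sphere 0 1

/-- The mean `E(ρ) = ∫ v dρ(v)`. -/
def meanM {d : ℕ} (ρ : Measure (EuclideanSpace ℝ (Fin d))) : EuclideanSpace ℝ (Fin d) :=
  ∫ v, v ∂ρ

/-- The variance `V(ρ) = (1/2) ∫ |v - E(ρ)|² dρ(v)`. -/
def varM {d : ℕ} (ρ : Measure (EuclideanSpace ℝ (Fin d))) : ℝ :=
  (1/2) * ∫ v, ‖v - meanM ρ‖ ^ 2 ∂ρ

/-- `‖ω_α‖_{L¹(ρ)} = ∫ exp(-α 𝓔(v)) dρ(v)`. -/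
def wNorm {d : ℕ} (𝓔 : EuclideanSpace ℝ (Fin d) → ℝ) (α : ℝ)
    (ρ : Measure (EuclideanSpace ℝ (Fin d))) : ℝ :=
  ∫ v, Real.exp (-α * 𝓔 v) ∂ρ

/-- The weighted mean `v_α(ρ) = (∫ v exp(-α 𝓔(v)) dρ(v)) / ‖ω_α‖_{L¹(ρ)}`. -/
def vAlpha {d : ℕ} (𝓔 : EuclideanSpace ℝ (Fin d) → ℝ) (α : ℝ)
    (ρ : Measure (EuclideanSpace ℝ (Fin d))) : EuclideanSpace ℝ (Fin d) :=
  (wNorm 𝓔 α ρ)⁻¹ • ∫ v, Real.exp (-α * 𝓔 v) • v ∂ρ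

/-- `𝓔̲ = inf_{𝕊^{d-1}} 𝓔`. -/
def eInf {d : ℕ} (𝓔 : EuclideanSpace ℝ (Fin d) → ℝ) : ℝ := sInf (𝓔 '' sph d)

/-- `𝓔̄ = sup_{𝕊^{d-1}} 𝓔`. -/
def eSup {d : ℕ} (𝓔 : EuclideanSpace ℝ (Fin d) → ℝ) : ℝ := sSup (𝓔 '' sph d)

/-- `C_{α,𝓔} = exp(α(𝓔̄ - 𝓔̲))`. -/
def Cae {d : ℕ} (𝓔 : EuclideanSpace ℝ (Fin d) → ℝ) (α : ℝ) : ℝ :=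
  Real.exp (α * (eSup 𝓔 - eInf 𝓔))

theorem sq_integral_le_integral_sq {Ω : Type*} [MeasurableSpace Ω] {μ : Measure Ω}
    [IsProbabilityMeasure μ] {f : Ω → ℝ} (hf : MemLp f 2 μ) :
    (∫ x, f x ∂μ) ^ 2 ≤ ∫ x, f x ^ 2 ∂μ := by
  have h := ProbabilityTheory.variance_nonneg f μ
  rw [ProbabilityTheory.variance_eq_sub hf] at h
  simpa using h

theorem integrable_id_of_ae_mem_sph {d : ℕ} {ρ : Measure (EuclideanSpace ℝ (Fin d))}
    [IsProbabilityMeasure ρ] (hsupp : ∀ᵐ v ∂ρ, v ∈ sph d) : Integrable (fun v => v) ρ := by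
  refine Integrable.of_bound aestronglyMeasurable_id 1 ?_
  filter_upwards [hsupp] with v hv
  simpa [sph] using hv.le

theorem integral_norm_sub_sq {d : ℕ} {ρ : Measure (EuclideanSpace ℝ (Fin d))}
    [IsProbabilityMeasure ρ] (hsupp : ∀ᵐ v ∂ρ, v ∈ sph d) (a : EuclideanSpace ℝ (Fin d)) :
    ∫ v, ‖v - a‖ ^ 2 ∂ρ = 1 + ‖a‖ ^ 2 - 2 * ⟪a, meanM ρ⟫ := by
  have hint := integrable_id_of_ae_mem_sph hsupp
  have hcongr : (fun v => ‖v - a‖ ^ 2) =ᵐ[ρ] fun v => (1 + ‖a‖ ^ 2) - 2 * ⟪a, v⟫ := by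
    filter_upwards [hsupp] with v hv
    have hv1 : ‖v‖ = 1 := by simpa [sph] using hv
    rw [norm_sub_sq_real, hv1, real_inner_comm]
    ring
  rw [integral_congr_ae hcongr,
    integral_sub (integrable_const _) ((hint.const_inner a).const_mul 2),
    integral_const_mul, integral_inner hint]
  simp [meanM]

theorem varM_eq {d : ℕ} {ρ : Measure (EuclideanSpace ℝ (Fin d))}
    [IsProbabilityMeasure ρ] (hsupp : ∀ᵐ v ∂ρ, v ∈ sph d) :
    varM ρ = (1 - ‖meanM ρ‖ ^ 2) / 2 := by
  rw [varM, integral_norm_sub_sq hsupp, real_inner_self_eq_norm_sq]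
  ring

theorem half_le_norm_meanM {d : ℕ} {ρ : Measure (EuclideanSpace ℝ (Fin d))}
    [IsProbabilityMeasure ρ] (hsupp : ∀ᵐ v ∂ρ, v ∈ sph d) (hV : varM ρ ≤ 3 / 8) :
    1 / 2 ≤ ‖meanM ρ‖ := by
  rw [varM_eq hsupp] at hV
  nlinarith [norm_nonneg (meanM ρ)]

theorem memLp_norm_sub {d : ℕ} {ρ : Measure (EuclideanSpace ℝ (Fin d))}
    [IsProbabilityMeasure ρ] (hsupp : ∀ᵐ v ∂ρ, v ∈ sph d) (a : EuclideanSpace ℝ (Fin d)) :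
    MemLp (fun v => ‖v - a‖) 2 ρ := by
  refine MemLp.of_bound (by fun_prop) (1 + ‖a‖) ?_
  filter_upwards [hsupp] with v hv
  have hv1 : ‖v‖ = 1 := by simpa [sph] using hv
  rw [norm_norm, ← hv1]
  exact norm_sub_le v a

theorem integral_norm_sub_normalized_mean_le {d : ℕ} {ρ : Measure (EuclideanSpace ℝ (Fin d))}
    [IsProbabilityMeasure ρ] (hsupp : ∀ᵐ v ∂ρ, v ∈ sph d) (hV : varM ρ ≤ 3 / 8) :
    ∫ v, ‖v - ‖meanM ρ‖⁻¹ • meanM ρ‖ ∂ρ ≤ 2 * √(2 / 3) * √(varM ρ) := by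
  have hm := half_le_norm_meanM hsupp hV
  have hm0 : ‖meanM ρ‖ ≠ 0 := by linarith
  have hVeq := varM_eq hsupp
  have hV0 : 0 ≤ varM ρ := mul_nonneg (by norm_num) (integral_nonneg fun _ => by positivity)
  have hsq := integral_norm_sub_sq hsupp (‖meanM ρ‖⁻¹ • meanM ρ)
  rw [norm_smul, norm_inv, norm_norm, inv_mul_cancel₀ hm0, real_inner_smul_left,
    real_inner_self_eq_norm_sq, pow_two ‖meanM ρ‖, inv_mul_cancel_left₀ hm0] at hsq
  refine le_of_sq_le_sq ?_ (by positivity)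
  rw [mul_pow, mul_pow, sq_sqrt (by norm_num), sq_sqrt hV0]
  refine (sq_integral_le_integral_sq (memLp_norm_sub hsupp _)).trans ?_
  rw [hsq, hVeq]
  nlinarith

theorem exp_sub_one_le_abs_mul_exp {x R : ℝ} (hx : x ≤ R) : exp x - 1 ≤ |x| * exp R := by
  have h : exp x - 1 ≤ x * exp x := by
    have h1 := mul_le_mul_of_nonneg_left (add_one_le_exp (-x)) (exp_pos x).le
    rw [← exp_add, add_neg_cancel, exp_zero] at h1
    linarith
  exact h.trans (mul_le_mul (le_abs_self x) (exp_le_exp.2 hx) (exp_pos x).le (abs_nonneg x))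

/-- Quantitative Laplace principle: the soft minimum of `𝓔` under `ρ` controls `𝓔 e`. -/
theorem add_log_wNorm_le {d : ℕ} {ρ : Measure (EuclideanSpace ℝ (Fin d))}
    [IsProbabilityMeasure ρ] (hsupp : ∀ᵐ v ∂ρ, v ∈ sph d)
    {𝓔 : EuclideanSpace ℝ (Fin d) → ℝ} (hmeas : Measurable 𝓔)
    (hbb : BddBelow (𝓔 '' sph d)) (hba : BddAbove (𝓔 '' sph d)) {c₁ : ℝ}
    (hLip : ∀ u ∈ sph d, ∀ v ∈ sph d, |𝓔 u - 𝓔 v| ≤ c₁ * ‖u - v‖)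
    {α : ℝ} (hα : 0 < α) {e : EuclideanSpace ℝ (Fin d)} (he : e ∈ sph d) :
    𝓔 e + 1 / α * log (wNorm 𝓔 α ρ) ≤ c₁ * Cae 𝓔 α * ∫ v, ‖v - e‖ ∂ρ := by
  have hωint : Integrable (fun v => exp (-α * 𝓔 v)) ρ := by
    refine Integrable.of_bound (by fun_prop) (exp (-α * eInf 𝓔)) ?_
    filter_upwards [hsupp] with v hv
    have := csInf_le hbb (Set.mem_image_of_mem 𝓔 hv)
    rw [norm_of_nonneg (exp_pos _).le, exp_le_exp]
    exact mul_le_mul_of_nonpos_left this (by linarith)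
  have hω : 0 < wNorm 𝓔 α ρ := integral_exp_pos hωint
  have hnint : Integrable (fun v => ‖v - e‖) ρ :=
    (memLp_norm_sub hsupp e).integrable (by norm_num)
  have hle : exp (α * 𝓔 e) * wNorm 𝓔 α ρ - 1 ≤ α * (c₁ * Cae 𝓔 α * ∫ v, ‖v - e‖ ∂ρ) := by
    have hmono : ∫ v, (exp (α * 𝓔 e) * exp (-α * 𝓔 v) - 1) ∂ρ
        ≤ ∫ v, α * (c₁ * Cae 𝓔 α * ‖v - e‖) ∂ρ := by
      refine integral_mono_ae ((hωint.const_mul _).sub (integrable_const _))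
        ((hnint.const_mul _).const_mul _) ?_
      filter_upwards [hsupp] with v hv
      have h1 := csInf_le hbb (Set.mem_image_of_mem 𝓔 hv)
      have h2 := le_csSup hba (Set.mem_image_of_mem 𝓔 he)
      have hR : α * (𝓔 e - 𝓔 v) ≤ α * (eSup 𝓔 - eInf 𝓔) :=
        mul_le_mul_of_nonneg_left (sub_le_sub h2 h1) hα.le
      have hL := hLip e he v hv
      calc exp (α * 𝓔 e) * exp (-α * 𝓔 v) - 1 = exp (α * (𝓔 e - 𝓔 v)) - 1 := by
            rw [← exp_add]; ring_nf
        _ ≤ |α * (𝓔 e - 𝓔 v)| * Cae 𝓔 α := exp_sub_one_le_abs_mul_exp hR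
        _ = α * |𝓔 e - 𝓔 v| * Cae 𝓔 α := by rw [abs_mul, abs_of_pos hα]
        _ ≤ α * (c₁ * ‖e - v‖) * Cae 𝓔 α :=
            mul_le_mul_of_nonneg_right (mul_le_mul_of_nonneg_left hL hα.le) (exp_pos _).le
        _ = α * (c₁ * Cae 𝓔 α * ‖v - e‖) := by rw [norm_sub_rev]; ring
    rw [integral_sub (hωint.const_mul _) (integrable_const _), integral_const_mul,
      integral_const_mul, integral_const_mul] at hmono
    simpa [wNorm] using hmono
  have hlog := log_le_sub_one_of_pos (mul_pos (exp_pos (α * 𝓔 e)) hω)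
  rw [log_mul (exp_pos _).ne' hω.ne', log_exp] at hlog
  refine le_of_mul_le_mul_left ?_ hα
  have : α * (𝓔 e + 1 / α * log (wNorm 𝓔 α ρ)) = α * 𝓔 e + log (wNorm 𝓔 α ρ) := by
    field_simp
  linarith

/-- Intermediate claim in the proof of Proposition 2.1: if
`-(1/α) log ‖ω_α‖_{L¹(ρ)} - 𝓔̲ ≤ ε`, then
`0 ≤ 𝓔(E(ρ)/|E(ρ)|) - 𝓔̲ ≤ 2√(2/3) c₁ C_{α,𝓔} V(ρ)^{1/2} + ε`. -/
theorem stmt_5 (d : ℕ) (hd : 2 ≤ d)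
    (ρ : Measure (EuclideanSpace ℝ (Fin d))) [IsProbabilityMeasure ρ]
    (hsupp : ∀ᵐ v ∂ρ, v ∈ sph d)
    (𝓔 : EuclideanSpace ℝ (Fin d) → ℝ) (hmeas : Measurable 𝓔)
    (hbb : BddBelow (𝓔 '' sph d)) (hba : BddAbove (𝓔 '' sph d))
    (c₁ : ℝ) (hc₁ : 0 ≤ c₁)
    (hLip : ∀ u ∈ sph d, ∀ v ∈ sph d, |𝓔 u - 𝓔 v| ≤ c₁ * ‖u - v‖)
    (α : ℝ) (hα : 0 < α)
    (hV : varM ρ ≤ 3/8)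
    (ε : ℝ) (hε : 0 ≤ ε)
    (hlog : -(1/α) * Real.log (wNorm 𝓔 α ρ) - eInf 𝓔 ≤ ε) :
    0 ≤ 𝓔 (‖meanM ρ‖⁻¹ • meanM ρ) - eInf 𝓔
      ∧ 𝓔 (‖meanM ρ‖⁻¹ • meanM ρ) - eInf 𝓔
        ≤ 2 * Real.sqrt (2/3) * c₁ * Cae 𝓔 α * Real.sqrt (varM ρ) + ε := by
  have hm := half_le_norm_meanM hsupp hV
  have he : ‖meanM ρ‖⁻¹ • meanM ρ ∈ sph d := by
    have hm0 : ‖meanM ρ‖ ≠ 0 := by linarith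
    simp [sph, norm_smul, hm0]
  refine ⟨sub_nonneg.2 (csInf_le hbb (Set.mem_image_of_mem 𝓔 he)), ?_⟩
  have h1 := add_log_wNorm_le hsupp hmeas hbb hba hLip hα he
  have h2 := mul_le_mul_of_nonneg_left (integral_norm_sub_normalized_mean_le hsupp hV)
    (mul_nonneg hc₁ (exp_pos (α * (eSup 𝓔 - eInf 𝓔))).le)
  rw [← Cae] at h2
  linarith
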